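/- arXiv:1503.08571 — 2 statements merged into one kernel-verified Lean document; each statement's English description precedes it below -/
import Mathlib

section
/- Let c ∈ C(X_A, ℤ) be such that [c] ∈ H^A_+ is an order unit, and let N_c ∈ ℕ satisfy N_c[c] − [1] ∈ H^A_+, where 1 denotes the constant function 1. Then for every n ∈ ℕ and every periodic point x ∈ X_A with σ_A^n(x) = x, one has Σ_{i=0}^{n−1} c(σ_A^i(x)) ≥ n/N_c. -/
open scoped BigOperators NNReal

namespace OneSidedMarkov

variable {N M : ℕ}

/-- The matrix has entries in `{0, 1}`. -/
def IsZeroOne (A : Matrix (Fin N) (Fin N) ℤ) : Prop := ∀ i j, A i j = 0 ∨ A i j = 1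

/-- The matrix is irreducible. -/
def IsIrreducible (A : Matrix (Fin N) (Fin N) ℤ) : Prop :=
  ∀ i j, ∃ m : ℕ, 0 < m ∧ (A ^ m) i j ≠ 0

/-- The matrix is a permutation matrix. -/
def IsPermutationMatrix (A : Matrix (Fin N) (Fin N) ℤ) : Prop :=
  ∃ e : Equiv.Perm (Fin N), ∀ i j, A i j = if e i = j then 1 else 0

/-- The one-sided topological Markov shift space `X_A`. -/
abbrev Space (A : Matrix (Fin N) (Fin N) ℤ) : Type :=
  {x : ℕ → Fin N // ∀ n, A (x n) (x (n + 1)) = 1}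

/-- The shift map `σ_A`. -/
def shift (A : Matrix (Fin N) (Fin N) ℤ) (x : Space A) : Space A :=
  ⟨fun n => x.1 (n + 1), fun n => x.2 (n + 1)⟩

lemma continuous_shift (A : Matrix (Fin N) (Fin N) ℤ) : Continuous (shift A) := by
  apply Continuous.subtype_mk
  exact continuous_pi fun n => (continuous_apply (n + 1)).comp continuous_subtype_val

/-- The shift map as a continuous map. -/
def shiftMap (A : Matrix (Fin N) (Fin N) ℤ) : C(Space A, Space A) :=
  ⟨shift A, continuous_shift A⟩

/-- The coboundary subgroup `{ g - g ∘ σ_A }` of `C(X_A, ℤ)`. -/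
def cobdySubgroup (A : Matrix (Fin N) (Fin N) ℤ) : AddSubgroup C(Space A, ℤ) :=
  AddSubgroup.closure {f | ∃ g : C(Space A, ℤ), f = g - g.comp (shiftMap A)}

/-- The ordered cohomology group `H^A = C(X_A, ℤ)/{g - g∘σ_A}`. -/
abbrev Coh (A : Matrix (Fin N) (Fin N) ℤ) : Type :=
  C(Space A, ℤ) ⧸ cobdySubgroup A

/-- The class `[f] ∈ H^A`. -/
def cohClass (A : Matrix (Fin N) (Fin N) ℤ) (f : C(Space A, ℤ)) : Coh A :=
  QuotientAddGroup.mk f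

/-- The positive cone `H^A_+`. -/
def CohPos (A : Matrix (Fin N) (Fin N) ℤ) : Set (Coh A) :=
  {c | ∃ f : C(Space A, ℤ), (∀ x, 0 ≤ f x) ∧ c = cohClass A f}

/-- `u` is an order unit of `(H^A, H^A_+)`. -/
def IsOrderUnit (A : Matrix (Fin N) (Fin N) ℤ) (u : Coh A) : Prop :=
  u ∈ CohPos A ∧ ∀ g : Coh A, ∃ n : ℕ, 0 < n ∧ n • u - g ∈ CohPos A

/-- The data `(l, k, b)` of a suspension. -/
structure SuspData (A : Matrix (Fin N) (Fin N) ℤ) where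
  l : C(Space A, ℝ)
  k : C(Space A, ℝ)
  b : C(Space A, ℝ)

/-- `c = l - k`. -/
def cFun {A : Matrix (Fin N) (Fin N) ℤ} (T : SuspData A) (x : Space A) : ℝ :=
  T.l x - T.k x

/-- `(l, k, b)` is a suspension triplet for `(X_A, σ_A)`. -/
def IsSuspTriplet {A : Matrix (Fin N) (Fin N) ℤ} (T : SuspData A) : Prop :=
  (∀ x, 0 ≤ T.l x) ∧ (∀ x, 0 ≤ T.k x) ∧
  (∃ c : C(Space A, ℤ), (∀ x, (c x : ℝ) = cFun T x) ∧ IsOrderUnit A (cohClass A c)) ∧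
  (∀ x, ∃ m : ℕ, T.l x - T.b x = m) ∧
  (∀ x, ∃ m : ℕ, T.k x - T.b (shift A x) = m)

/-- The space `X_{A,b}^ℝ = {(x, r) : r ≥ b(x)}`. -/
abbrev BaseSpace {A : Matrix (Fin N) (Fin N) ℤ} (T : SuspData A) : Type :=
  {p : Space A × ℝ // T.b p.1 ≤ p.2}

/-- The elementary relation `(x, r) ∼ (σ_A(x), r - c(x))` for `r ≥ l(x)`. -/
def SuspRel {A : Matrix (Fin N) (Fin N) ℤ} (T : SuspData A)
    (p q : BaseSpace T) : Prop :=
  T.l p.1.1 ≤ p.1.2 ∧ q.1 = (shift A p.1.1, p.1.2 - cFun T p.1.1)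

/-- The equivalence relation `∼_{l,k}` generated by `SuspRel`. -/
def suspSetoid {A : Matrix (Fin N) (Fin N) ℤ} (T : SuspData A) : Setoid (BaseSpace T) :=
  ⟨Relation.EqvGen (SuspRel T), Relation.EqvGen.is_equivalence _⟩

/-- The one-sided suspension `S_{A,b}^{l,k}` with the quotient topology. -/
abbrev Susp {A : Matrix (Fin N) (Fin N) ℤ} (T : SuspData A) : Type :=
  Quotient (suspSetoid T)

/-- The class `[x, r]`. -/
def mkSusp {A : Matrix (Fin N) (Fin N) ℤ} (T : SuspData A) (p : BaseSpace T) : Susp T :=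
  Quotient.mk (suspSetoid T) p

/-- The base map `x ↦ [x, b(x)]`. -/
def basePoint {A : Matrix (Fin N) (Fin N) ℤ} (T : SuspData A) (x : Space A) : Susp T :=
  mkSusp T ⟨(x, T.b x), le_refl _⟩

/-- Translation by `t ≥ 0` on `X_{A,b}^ℝ`. -/
def shiftPt {A : Matrix (Fin N) (Fin N) ℤ} (T : SuspData A) (t : ℝ≥0)
    (p : BaseSpace T) : BaseSpace T :=
  ⟨(p.1.1, p.1.2 + t), le_trans p.2 (le_add_of_nonneg_right t.2)⟩

lemma suspRel_shiftPt {A : Matrix (Fin N) (Fin N) ℤ} (T : SuspData A) (t : ℝ≥0)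
    {p q : BaseSpace T} (h : SuspRel T p q) : SuspRel T (shiftPt T t p) (shiftPt T t q) := by
  obtain ⟨h1, h2⟩ := h
  refine ⟨le_trans h1 (le_add_of_nonneg_right t.2), ?_⟩
  show (q.1.1, q.1.2 + (t : ℝ)) = _
  rw [h2]
  show (shift A p.1.1, p.1.2 - cFun T p.1.1 + (t : ℝ))
      = (shift A p.1.1, p.1.2 + (t : ℝ) - cFun T p.1.1)
  congr 1
  ring

lemma eqvGen_map {α : Type*} {r r' : α → α → Prop} (f : α → α)
    (hf : ∀ a b, r a b → r' (f a) (f b)) :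
    ∀ a b, Relation.EqvGen r a b → Relation.EqvGen r' (f a) (f b) := by
  intro a b h
  induction h with
  | rel a b hab => exact Relation.EqvGen.rel _ _ (hf a b hab)
  | refl a => exact Relation.EqvGen.refl _
  | symm a b _ ih => exact Relation.EqvGen.symm _ _ ih
  | trans a b c _ _ ih1 ih2 => exact Relation.EqvGen.trans _ _ _ ih1 ih2

/-- The flow `φ_{A,t}([x, r]) = [x, r + t]`, `t ∈ ℝ_+`, on the one-sided suspension. -/
def flow {A : Matrix (Fin N) (Fin N) ℤ} (T : SuspData A) (t : ℝ≥0) :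
    Susp T → Susp T :=
  Quotient.map' (shiftPt T t)
    (fun p q h => eqvGen_map (shiftPt T t) (fun _ _ hr => suspRel_shiftPt T t hr) p q h)

/-- The standard suspension data `(1, 0, 0)`. -/
def stdData (A : Matrix (Fin N) (Fin N) ℤ) : SuspData A := ⟨1, 0, 0⟩

/-- The standard one-sided suspension `S_A^1`. -/
abbrev StdSusp (A : Matrix (Fin N) (Fin N) ℤ) : Type := Susp (stdData A)

/-- The standard base map `s_A(x) = [x, 0]`. -/
def stdBase (A : Matrix (Fin N) (Fin N) ℤ) : Space A → StdSusp A :=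
  basePoint (stdData A)

/-- The orbit equations of a continuous orbit equivalence. -/
def OrbitEqFns (A : Matrix (Fin N) (Fin N) ℤ) (B : Matrix (Fin M) (Fin M) ℤ)
    (h : Space A ≃ₜ Space B) (k1 l1 : C(Space A, ℕ)) (k2 l2 : C(Space B, ℕ)) : Prop :=
  (∀ x : Space A, (shift B)^[k1 x] (h (shift A x)) = (shift B)^[l1 x] (h x)) ∧
  (∀ y : Space B, (shift A)^[k2 y] (h.symm (shift B y)) = (shift A)^[l2 y] (h.symm y))

/-- `(X_A, σ_A)` and `(X_B, σ_B)` are continuously orbit equivalent. -/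
def ContOrbitEquiv (A : Matrix (Fin N) (Fin N) ℤ) (B : Matrix (Fin M) (Fin M) ℤ) : Prop :=
  ∃ h : Space A ≃ₜ Space B, ∃ k1 l1 : C(Space A, ℕ), ∃ k2 l2 : C(Space B, ℕ),
    OrbitEqFns A B h k1 l1 k2 l2

/-- One-sided flow equivalence via the homeomorphism `h`. -/
def FlowEquivVia (A : Matrix (Fin N) (Fin N) ℤ) (B : Matrix (Fin M) (Fin M) ℤ)
    (h : Space A ≃ₜ Space B) : Prop :=
  ∃ T₁ : SuspData A, IsSuspTriplet T₁ ∧ ∃ T₂ : SuspData B, IsSuspTriplet T₂ ∧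
  ∃ Φ₁ : Susp T₁ → StdSusp B, Continuous Φ₁ ∧
  ∃ Φ₂ : Susp T₂ → StdSusp A, Continuous Φ₂ ∧
  (∀ (t : ℝ≥0) (p : Susp T₁), Φ₁ (flow T₁ t p) = flow (stdData B) t (Φ₁ p)) ∧
  (∀ x : Space A, Φ₁ (basePoint T₁ x) = stdBase B (h x)) ∧
  (∀ (t : ℝ≥0) (q : Susp T₂), Φ₂ (flow T₂ t q) = flow (stdData A) t (Φ₂ q)) ∧
  (∀ y : Space B, Φ₂ (basePoint T₂ y) = stdBase A (h.symm y))

/-- `(X_A, σ_A)` and `(X_B, σ_B)` are one-sided flow equivalent. -/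
def OneSidedFlowEquiv (A : Matrix (Fin N) (Fin N) ℤ) (B : Matrix (Fin M) (Fin M) ℤ) : Prop :=
  ∃ h : Space A ≃ₜ Space B, FlowEquivVia A B h

/-- `f^m(x) = Σ_{i<m} f(σ_A^i(x))` for integer-valued `f`. -/
def birk (A : Matrix (Fin N) (Fin N) ℤ) (f : Space A → ℤ) (m : ℕ) (x : Space A) : ℤ :=
  ∑ i ∈ Finset.range m, f ((shift A)^[i] x)

/-- `f^m(x) = Σ_{i<m} f(σ_A^i(x))` for real-valued `f`. -/
def birkR (A : Matrix (Fin N) (Fin N) ℤ) (f : Space A → ℝ) (m : ℕ) (x : Space A) : ℝ :=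
  ∑ i ∈ Finset.range m, f ((shift A)^[i] x)

/-- `f^m(x) = Σ_{i<m} f(σ_A^i(x))` for ℕ-valued `f`. -/
def birkN (A : Matrix (Fin N) (Fin N) ℤ) (f : Space A → ℕ) (m : ℕ) (x : Space A) : ℕ :=
  ∑ i ∈ Finset.range m, f ((shift A)^[i] x)

/-- The map `Ψ_h` associated with a continuous orbit equivalence. -/
def psi (A : Matrix (Fin N) (Fin N) ℤ) (B : Matrix (Fin M) (Fin M) ℤ)
    (h : Space A → Space B) (l1 k1 : Space A → ℕ) (f : Space B → ℤ) :
    Space A → ℤ :=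
  fun x => (∑ i ∈ Finset.range (l1 x), f ((shift B)^[i] (h x)))
    - ∑ j ∈ Finset.range (k1 x), f ((shift B)^[j] (h (shift A x)))

/-- The dynamical zeta function `ζ_{A,f}(s)` with potential `f`. -/
noncomputable def zeta (A : Matrix (Fin N) (Fin N) ℤ) (f : Space A → ℤ) (s : ℂ) : ℂ :=
  Complex.exp (∑' n : ℕ, (1 / (n + 1 : ℂ)) *
    ∑' x : {x : Space A // (shift A)^[n + 1] x = x},
      Complex.exp (-s * ((birk A f (n + 1) x.1 : ℤ) : ℂ)))

/-- `γ` is a periodic orbit of `(X_A, σ_A)`. -/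
def IsPerOrbit (A : Matrix (Fin N) (Fin N) ℤ) (γ : Set (Space A)) : Prop :=
  ∃ (x : Space A) (p : ℕ), 0 < p ∧ (shift A)^[p] x = x ∧
    (∀ q : ℕ, 0 < q → (shift A)^[q] x = x → p ≤ q) ∧
    γ = {y | ∃ i : ℕ, i < p ∧ y = (shift A)^[i] x}

/-- `τ` is a primitive periodic orbit of the flow on the one-sided suspension. -/
def IsFlowOrbit {A : Matrix (Fin N) (Fin N) ℤ} (T : SuspData A) (τ : Set (Susp T)) : Prop :=
  ∃ u : Susp T, (∃ t : ℝ≥0, 0 < t ∧ flow T t u = u) ∧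
    τ = Set.range (fun t : ℝ≥0 => flow T t u)

/-- `ℓ(u) = min { t > 0 : φ_{A,t}(u) = u }`. -/
noncomputable def pointLen {A : Matrix (Fin N) (Fin N) ℤ} (T : SuspData A) (u : Susp T) : ℝ≥0 :=
  sInf {t : ℝ≥0 | 0 < t ∧ flow T t u = u}

/-- `ℓ(τ) = min { t > 0 : φ_{A,t}(u) = u for all u ∈ τ }`. -/
noncomputable def orbitLen {A : Matrix (Fin N) (Fin N) ℤ} (T : SuspData A)
    (τ : Set (Susp T)) : ℝ≥0 :=
  sInf {t : ℝ≥0 | 0 < t ∧ ∀ u ∈ τ, flow T t u = u}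

/-- The Birkhoff sum over `n` steps at `x`, as an additive homomorphism on `C(X_A, ℤ)`. -/
def birkHom (A : Matrix (Fin N) (Fin N) ℤ) (n : ℕ) (x : Space A) : C(Space A, ℤ) →+ ℤ where
  toFun f := birk A f n x
  map_zero' := by simp [birk]
  map_add' f g := by simp [birk, Finset.sum_add_distrib]

lemma birk_sub_comp_shift (A : Matrix (Fin N) (Fin N) ℤ) (g : C(Space A, ℤ)) (n : ℕ)
    (x : Space A) :
    birk A (g - g.comp (shiftMap A)) n x = g x - g ((shift A)^[n] x) := by
  refine (Finset.sum_congr rfl fun i _ => ?_).trans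
    (Finset.sum_range_sub' (fun i => g ((shift A)^[i] x)) n)
  simp only [Function.iterate_succ_apply']
  rfl

lemma cobdySubgroup_le_ker_birkHom (A : Matrix (Fin N) (Fin N) ℤ) {n : ℕ} {x : Space A}
    (hx : (shift A)^[n] x = x) : cobdySubgroup A ≤ (birkHom A n x).ker := by
  refine (AddSubgroup.closure_le _).2 ?_
  rintro _ ⟨g, rfl⟩
  exact (birk_sub_comp_shift A g n x).trans (by rw [hx, sub_self])

/-- Birkhoff sums along a periodic orbit are nonnegative on representatives of positive classes. -/
lemma birkHom_nonneg_of_cohClass_mem_cohPos (A : Matrix (Fin N) (Fin N) ℤ) {n : ℕ}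
    {x : Space A} (hx : (shift A)^[n] x = x) {f : C(Space A, ℤ)}
    (hf : cohClass A f ∈ CohPos A) : 0 ≤ birkHom A n x f := by
  obtain ⟨g, hg, hfg⟩ := hf
  have hker := cobdySubgroup_le_ker_birkHom A hx (QuotientAddGroup.eq.1 hfg)
  rw [AddMonoidHom.mem_ker, map_add, map_neg, neg_add_eq_zero] at hker
  rw [hker]
  change 0 ≤ ∑ i ∈ Finset.range n, g ((shift A)^[i] x)
  exact Finset.sum_nonneg fun i _ => hg _

theorem birkhoff_lower_bound_on_periodic_points
    {N : ℕ} (A : Matrix (Fin N) (Fin N) ℤ)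
    (hN : 1 < N) (hA01 : IsZeroOne A)
    (hAirr : IsIrreducible A) (hAnp : ¬ IsPermutationMatrix A)
    (c : C(Space A, ℤ)) (hc : IsOrderUnit A (cohClass A c))
    (Nc : ℕ) (hNc : 0 < Nc)
    (hcu : Nc • cohClass A c - cohClass A 1 ∈ CohPos A) :
    ∀ (n : ℕ) (x : Space A), (shift A)^[n] x = x →
      (n : ℝ) / (Nc : ℝ) ≤ (birk A (⇑c) n x : ℝ) := by
  intro n x hx
  have h : 0 ≤ birkHom A n x (Nc • c - 1) := birkHom_nonneg_of_cohClass_mem_cohPos A hx hcu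
  have hone : birkHom A n x 1 = n := by simp [birkHom, birk]
  rw [map_sub, map_nsmul, hone, nsmul_eq_mul, sub_nonneg] at h
  rw [div_le_iff₀' (by exact_mod_cast hNc)]
  exact_mod_cast h

end OneSidedMarkov
end

section
/- Let A = [[1,1],[1,1]] and B = [[1,1],[1,0]] (so (X_A, σ_A) is the full 2-shift and (X_B, σ_B) is the golden mean shift, whose points are the sequences of 1, 2 in which the word (2,2) does not occur). Then (X_A, σ_A) and (X_B, σ_B) are one-sided flow equivalent; indeed, the homeomorphism h : X_A → X_B obtained by substituting the word (2,1) for each occurrence of the symbol 2, proceeding from the leftmost coordinate, together with the continuous functions k_1 ≡ 0 and l_1 = 1 on the cylinder {x ∈ X_A : x_1 = 1}, l_1 = 2 on {x ∈ X_A : x_1 = 2}, and k_2 = 0, l_2 = 1 on {y ∈ X_B : y_1 = 1}, k_2 = 1, l_2 = 1 on {y ∈ X_B : y_1 = 2}, satisfies σ_B^{k_1(x)}(h(σ_A(x))) = σ_B^{l_1(x)}(h(x)) for all x ∈ X_A and σ_A^{k_2(y)}(h^{−1}(σ_B(y))) = σ_A^{l_2(y)}(h^{−1}(y)) for all y ∈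 X_B, so the two shifts are continuously orbit equivalent and hence one-sided flow equivalent. -/
open scoped BigOperators NNReal

namespace OneSidedMarkov

variable {N M : ℕ}

/-- The full 2-shift matrix. -/
def matA2 : Matrix (Fin 2) (Fin 2) ℤ := !![1, 1; 1, 1]

/-- The golden mean shift matrix (the word `(2,2)` is forbidden). -/
def matB2 : Matrix (Fin 2) (Fin 2) ℤ := !![1, 1; 1, 0]

/-- `l_1 = 1` on the cylinder of the symbol `1` and `l_1 = 2` on the cylinder of `2`. -/
def l1ex : C(Space matA2, ℕ) where
  toFun x := if x.1 0 = 0 then 1 else 2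
  continuous_toFun := by
    have h1 : Continuous (fun x : Space matA2 => x.1 0) :=
      (continuous_apply 0).comp continuous_subtype_val
    exact (continuous_of_discreteTopology
      (f := fun i : Fin 2 => if i = 0 then (1 : ℕ) else 2)).comp h1

/-- `k_2 = 0` on the cylinder of the symbol `1` and `k_2 = 1` on the cylinder of `2`. -/
def k2ex : C(Space matB2, ℕ) where
  toFun y := if y.1 0 = 0 then 0 else 1
  continuous_toFun := by
    have h1 : Continuous (fun y : Space matB2 => y.1 0) :=
      (continuous_apply 0).comp continuous_subtype_val
    exact (continuous_of_discreteTopology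
      (f := fun i : Fin 2 => if i = 0 then (0 : ℕ) else 1)).comp h1

instance instCompactSpaceSpace (A : Matrix (Fin N) (Fin N) ℤ) : CompactSpace (Space A) := by
  refine isCompact_iff_compactSpace.mp (IsClosed.isCompact ?_)
  have h (n : ℕ) : Continuous fun x : ℕ → Fin N => A (x n) (x (n + 1)) := by
    have hp : Continuous fun p : Fin N × Fin N => A p.1 p.2 := continuous_of_discreteTopology
    have hq : Continuous fun x : ℕ → Fin N => (x n, x (n + 1)) :=
      (continuous_apply n).prodMk (continuous_apply (n + 1))
    exact hp.comp hq
  have hset : IsClosed {x : ℕ → Fin N | ∀ n, A (x n) (x (n + 1)) = 1} := by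
    simp only [Set.ofPred_forall]
    exact isClosed_iInter fun n => isClosed_eq (h n) continuous_const
  exact hset

/-- A positive class with a multiple represented by a function `≥ 1` is an order unit. -/
lemma isOrderUnit_of_nsmul_eq {A : Matrix (Fin N) (Fin N) ℤ} {u : Coh A} (hu : u ∈ CohPos A)
    {m : ℕ} (hm : 0 < m) {d : C(Space A, ℤ)} (hd : ∀ x, 1 ≤ d x) (h : m • u = cohClass A d) :
    IsOrderUnit A u := by
  refine ⟨hu, fun g => ?_⟩
  obtain ⟨f, rfl⟩ := QuotientAddGroup.mk_surjective g
  obtain ⟨K, hK⟩ : ∃ K : ℕ, ∀ x, f x ≤ K := by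
    obtain ⟨C, hC⟩ := (isCompact_range f.continuous).bddAbove
    exact ⟨C.toNat, fun x => (hC ⟨x, rfl⟩).trans (Int.self_le_toNat C)⟩
  refine ⟨(K + 1) * m, by positivity, (K + 1) • d - f, fun x => ?_, ?_⟩
  · have h1 := hK x
    have h2 := hd x
    rw [ContinuousMap.sub_apply, ContinuousMap.smul_apply, nsmul_eq_mul]
    push_cast
    nlinarith
  · rw [mul_smul, h]
    rfl

/-- The suspension data `(l, k, 0)` attached to integer-valued `l` and `k`. -/
def natData {A : Matrix (Fin N) (Fin N) ℤ} (l k : C(Space A, ℕ)) : SuspData A where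
  l := ⟨fun x => (l x : ℝ), continuous_of_discreteTopology.comp l.continuous⟩
  k := ⟨fun x => (k x : ℝ), continuous_of_discreteTopology.comp k.continuous⟩
  b := 0

/-- The integer-valued function `l - k`. -/
def natDiff {A : Matrix (Fin N) (Fin N) ℤ} (l k : C(Space A, ℕ)) : C(Space A, ℤ) where
  toFun x := (l x : ℤ) - k x
  continuous_toFun :=
    (continuous_of_discreteTopology.comp l.continuous).sub
      (continuous_of_discreteTopology.comp k.continuous)

lemma isSuspTriplet_natData {A : Matrix (Fin N) (Fin N) ℤ} {l k : C(Space A, ℕ)}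
    (h : IsOrderUnit A (cohClass A (natDiff l k))) : IsSuspTriplet (natData l k) := by
  refine ⟨fun x => Nat.cast_nonneg (l x), fun x => Nat.cast_nonneg (k x),
    ⟨natDiff l k, fun x => ?_, h⟩, fun x => ⟨l x, sub_zero _⟩, fun x => ⟨k x, sub_zero _⟩⟩
  simp [natDiff, natData, cFun]

lemma mkSusp_stdData_iterate (A : Matrix (Fin N) (Fin N) ℤ) (n : ℕ) :
    ∀ (x : Space A) (r s : ℝ) (hr : 0 ≤ r) (hs : 0 ≤ s), r = s + n →
      mkSusp (stdData A) ⟨(x, r), hr⟩ = mkSusp (stdData A) ⟨((shift A)^[n] x, s), hs⟩ := by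
  induction n with
  | zero =>
    intro x r s hr hs h
    obtain rfl : r = s := by simpa using h
    rfl
  | succ n ih =>
    intro x r s hr hs h
    push_cast at h
    rw [Function.iterate_succ_apply, ← ih (shift A x) (s + n) s (by positivity) hs rfl]
    refine Quotient.sound (Relation.EqvGen.rel _ _ ⟨?_, ?_⟩)
    · change (1 : ℝ) ≤ r
      have : (0 : ℝ) ≤ n := n.cast_nonneg
      linarith
    · change (shift A x, s + n) = (shift A x, r - ((1 : ℝ) - 0))
      rw [h]
      congr 1
      ring

/-- The map `[x, r] ↦ [f x, r]` induced by a map `f` satisfying an orbit equation. -/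
def suspMap {A : Matrix (Fin N) (Fin N) ℤ} {B : Matrix (Fin M) (Fin M) ℤ}
    (f : Space A → Space B) (l k : C(Space A, ℕ))
    (h : ∀ x, (shift B)^[k x] (f (shift A x)) = (shift B)^[l x] (f x)) :
    Susp (natData l k) → StdSusp B :=
  Quotient.lift (fun p => mkSusp (stdData B) ⟨(f p.1.1, p.1.2), p.2⟩) (by
    intro p q hpq
    induction hpq with
    | rel p q hpq =>
      obtain ⟨⟨x, r⟩, hr⟩ := p
      obtain ⟨⟨y, s⟩, hs⟩ := q
      obtain ⟨h1, h2⟩ := hpq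
      change (l x : ℝ) ≤ r at h1
      change (y, s) = (shift A x, r - ((l x : ℝ) - k x)) at h2
      obtain ⟨rfl, rfl⟩ := Prod.mk.inj h2
      have h3 : 0 ≤ r - l x := sub_nonneg.mpr h1
      change mkSusp (stdData B) ⟨(f x, r), hr⟩ =
        mkSusp (stdData B) ⟨(f (shift A x), r - ((l x : ℝ) - k x)), hs⟩
      rw [mkSusp_stdData_iterate B (l x) (f x) r (r - l x) hr h3 (by ring),
        mkSusp_stdData_iterate B (k x) (f (shift A x)) _ (r - l x) hs h3 (by ring)]
      simp only [h]
    | refl => rfl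
    | symm _ _ _ ih => exact ih.symm
    | trans _ _ _ _ _ ih1 ih2 => exact ih1.trans ih2)

lemma continuous_suspMap {A : Matrix (Fin N) (Fin N) ℤ} {B : Matrix (Fin M) (Fin M) ℤ}
    {f : Space A → Space B} (hf : Continuous f) (l k : C(Space A, ℕ))
    (h : ∀ x, (shift B)^[k x] (f (shift A x)) = (shift B)^[l x] (f x)) :
    Continuous (suspMap f l k h) := by
  refine continuous_quot_lift _ (continuous_quot_mk.comp (Continuous.subtype_mk ?_ _))
  exact (hf.comp (continuous_fst.comp continuous_subtype_val)).prodMk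
    (continuous_snd.comp continuous_subtype_val)

lemma suspMap_flow {A : Matrix (Fin N) (Fin N) ℤ} {B : Matrix (Fin M) (Fin M) ℤ}
    (f : Space A → Space B) (l k : C(Space A, ℕ))
    (h : ∀ x, (shift B)^[k x] (f (shift A x)) = (shift B)^[l x] (f x))
    (t : ℝ≥0) (p : Susp (natData l k)) :
    suspMap f l k h (flow (natData l k) t p) = flow (stdData B) t (suspMap f l k h p) := by
  induction p using Quotient.inductionOn
  rfl

/-- A continuous orbit equivalence whose cocycle functions are order units is a one-sided
flow equivalence. -/
lemma OrbitEqFns.flowEquivVia {A : Matrix (Fin N) (Fin N) ℤ} {B : Matrix (Fin M) (Fin M) ℤ}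
    {h : Space A ≃ₜ Space B} {k1 l1 : C(Space A, ℕ)} {k2 l2 : C(Space B, ℕ)}
    (H : OrbitEqFns A B h k1 l1 k2 l2)
    (h1 : IsOrderUnit A (cohClass A (natDiff l1 k1)))
    (h2 : IsOrderUnit B (cohClass B (natDiff l2 k2))) : FlowEquivVia A B h :=
  ⟨natData l1 k1, isSuspTriplet_natData h1, natData l2 k2, isSuspTriplet_natData h2,
    suspMap h l1 k1 H.1, continuous_suspMap h.continuous l1 k1 H.1,
    suspMap h.symm l2 k2 H.2, continuous_suspMap h.symm.continuous l2 k2 H.2,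
    suspMap_flow h l1 k1 H.1, fun _ => rfl, suspMap_flow h.symm l2 k2 H.2, fun _ => rfl⟩

/-- The tail of a sequence. -/
def tail (x : ℕ → Fin 2) : ℕ → Fin 2 := fun n => x (n + 1)

/-- Substitute the word `(1, 0)` for each occurrence of the symbol `1`. -/
def subst : ℕ → (ℕ → Fin 2) → Fin 2
  | 0, x => x 0
  | 1, x => if x 0 = 0 then subst 0 (tail x) else 0
  | n + 2, x => if x 0 = 0 then subst (n + 1) (tail x) else subst n (tail x)

/-- Replace each occurrence of the word `(1, 0)` by the symbol `1`. -/
def unsubst : ℕ → (ℕ → Fin 2) → Fin 2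
  | 0, y => y 0
  | n + 1, y => if y 0 = 0 then unsubst n (tail y) else unsubst n (tail (tail y))

lemma continuous_tail : Continuous tail :=
  continuous_pi fun n => continuous_apply (n + 1)

lemma continuous_ite_head {f g : (ℕ → Fin 2) → Fin 2} (hf : Continuous f) (hg : Continuous g) :
    Continuous fun x => if x 0 = 0 then f x else g x :=
  (continuous_of_discreteTopology
    (f := fun p : Fin 2 × Fin 2 × Fin 2 => if p.1 = 0 then p.2.1 else p.2.2)).comp
    ((continuous_apply 0).prodMk (hf.prodMk hg))

lemma continuous_subst : ∀ n, Continuous (subst n)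
  | 0 => continuous_apply 0
  | 1 => by
    change Continuous fun x : ℕ → Fin 2 => if x 0 = 0 then subst 0 (tail x) else 0
    exact continuous_ite_head ((continuous_subst 0).comp continuous_tail) continuous_const
  | n + 2 => by
    change Continuous fun x : ℕ → Fin 2 =>
      if x 0 = 0 then subst (n + 1) (tail x) else subst n (tail x)
    exact continuous_ite_head ((continuous_subst (n + 1)).comp continuous_tail)
      ((continuous_subst n).comp continuous_tail)

lemma continuous_unsubst : ∀ n, Continuous (unsubst n)
  | 0 => continuous_apply 0
  | n + 1 => by
    change Continuous fun x : ℕ → Fin 2 =>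
      if x 0 = 0 then unsubst n (tail x) else unsubst n (tail (tail x))
    exact continuous_ite_head ((continuous_unsubst n).comp continuous_tail)
      ((continuous_unsubst n).comp (continuous_tail.comp continuous_tail))

lemma subst_succ_of_eq_zero {x : ℕ → Fin 2} (hx : x 0 = 0) (n : ℕ) :
    subst (n + 1) x = subst n (tail x) := by
  cases n <;> simp [subst, hx]

lemma subst_one_of_ne_zero {x : ℕ → Fin 2} (hx : x 0 ≠ 0) : subst 1 x = 0 := by
  simp [subst, hx]

lemma subst_add_two_of_ne_zero {x : ℕ → Fin 2} (hx : x 0 ≠ 0) (n : ℕ) :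
    subst (n + 2) x = subst n (tail x) := by
  simp [subst, hx]

lemma matB2_eq_one_iff (i j : Fin 2) : matB2 i j = 1 ↔ i = 0 ∨ j = 0 := by
  fin_cases i <;> fin_cases j <;> simp [matB2]

lemma matA2_eq_one (i j : Fin 2) : matA2 i j = 1 := by
  fin_cases i <;> fin_cases j <;> simp [matA2]

lemma subst_eq_zero_or : ∀ (n : ℕ) (x : ℕ → Fin 2), subst n x = 0 ∨ subst (n + 1) x = 0
  | n, x => by
    by_cases hx : x 0 = 0
    · cases n with
      | zero => exact Or.inl hx
      | succ n =>
        rw [subst_succ_of_eq_zero hx, subst_succ_of_eq_zero hx]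
        exact subst_eq_zero_or n _
    · match n with
      | 0 => exact Or.inr (subst_one_of_ne_zero hx)
      | 1 => exact Or.inl (subst_one_of_ne_zero hx)
      | n + 2 =>
        rw [subst_add_two_of_ne_zero hx, show n + 2 + 1 = (n + 1) + 2 from rfl,
          subst_add_two_of_ne_zero hx]
        exact subst_eq_zero_or n _

lemma unsubst_subst : ∀ (n : ℕ) (x : ℕ → Fin 2), unsubst n (fun i => subst i x) = x n
  | 0, _ => rfl
  | n + 1, x => by
    by_cases hx : x 0 = 0
    · have h : tail (fun i => subst i x) = fun i => subst i (tail x) :=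
        funext fun i => subst_succ_of_eq_zero hx i
      simp only [unsubst, h]
      rw [if_pos (by exact hx), unsubst_subst n]
      rfl
    · have h : tail (tail fun i => subst i x) = fun i => subst i (tail x) :=
        funext fun i => subst_add_two_of_ne_zero hx i
      simp only [unsubst, h]
      rw [if_neg (by exact hx), unsubst_subst n]
      rfl

lemma tail_unsubst_of_eq_zero {y : ℕ → Fin 2} (hy : y 0 = 0) :
    tail (fun i => unsubst i y) = fun i => unsubst i (tail y) := by
  funext i
  simp [tail, unsubst, hy]

lemma tail_unsubst_of_ne_zero {y : ℕ → Fin 2} (hy : y 0 ≠ 0) :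
    tail (fun i => unsubst i y) = fun i => unsubst i (tail (tail y)) := by
  funext i
  simp [tail, unsubst, hy]

lemma subst_unsubst : ∀ (n : ℕ) (y : ℕ → Fin 2), (∀ i, y i = 0 ∨ y (i + 1) = 0) →
    subst n (fun i => unsubst i y) = y n
  | 0, _, _ => rfl
  | n + 1, y, hy => by
    by_cases h0 : y 0 = 0
    · rw [subst_succ_of_eq_zero (by exact h0), tail_unsubst_of_eq_zero h0,
        subst_unsubst n (tail y) fun i => hy (i + 1)]
      rfl
    · cases n with
      | zero =>
        rw [subst_one_of_ne_zero (by exact h0)]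
        exact ((hy 0).resolve_left h0).symm
      | succ n =>
        rw [subst_add_two_of_ne_zero (by exact h0), tail_unsubst_of_ne_zero h0,
          subst_unsubst n (tail (tail y)) fun i => hy (i + 2)]
        rfl

/-- The homeomorphism from the full 2-shift to the golden mean shift that substitutes the word
`(2, 1)` for the symbol `2`. -/
def substHomeo : Space matA2 ≃ₜ Space matB2 where
  toFun x := ⟨fun n => subst n x.1, fun n => (matB2_eq_one_iff _ _).mpr (subst_eq_zero_or n x.1)⟩
  invFun y := ⟨fun n => unsubst n y.1, fun _ => matA2_eq_one _ _⟩
  left_inv x := Subtype.ext (funext fun n => unsubst_subst n x.1)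
  right_inv y := Subtype.ext (funext fun n =>
    subst_unsubst n y.1 fun i => (matB2_eq_one_iff _ _).mp (y.2 i))
  continuous_toFun := Continuous.subtype_mk
    (continuous_pi fun n => (continuous_subst n).comp continuous_subtype_val) _
  continuous_invFun := Continuous.subtype_mk
    (continuous_pi fun n => (continuous_unsubst n).comp continuous_subtype_val) _

lemma orbitEqFns_substHomeo : OrbitEqFns matA2 matB2 substHomeo 0 l1ex k2ex 1 := by
  refine ⟨fun x => ?_, fun y => ?_⟩
  · by_cases hx : x.1 0 = 0
    · have hl : l1ex x = 1 := if_pos hx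
      rw [hl]
      exact Subtype.ext (funext fun n => (subst_succ_of_eq_zero hx n).symm)
    · have hl : l1ex x = 2 := if_neg hx
      rw [hl]
      exact Subtype.ext (funext fun n => (subst_add_two_of_ne_zero hx n).symm)
  · by_cases hy : y.1 0 = 0
    · have hk : k2ex y = 0 := if_pos hy
      rw [hk]
      exact Subtype.ext (tail_unsubst_of_eq_zero hy).symm
    · have hk : k2ex y = 1 := if_neg hy
      have hy1 : tail y.1 0 = 0 := ((matB2_eq_one_iff _ _).mp (y.2 0)).resolve_left hy
      rw [hk]
      exact Subtype.ext
        ((tail_unsubst_of_eq_zero hy1).trans (tail_unsubst_of_ne_zero hy).symm)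

lemma isOrderUnit_l1ex : IsOrderUnit matA2 (cohClass matA2 (natDiff l1ex 0)) := by
  have h : ∀ x, 1 ≤ natDiff l1ex 0 x := by
    intro x
    change (1 : ℤ) ≤ ((if x.1 0 = 0 then 1 else 2 : ℕ) : ℤ) - ((0 : ℕ) : ℤ)
    split_ifs <;> norm_num
  exact isOrderUnit_of_nsmul_eq ⟨_, fun x => zero_le_one.trans (h x), rfl⟩ one_pos h (one_smul _ _)

lemma natDiff_one_k2ex_apply (y : Space matB2) :
    natDiff 1 k2ex y = if y.1 0 = 0 then 1 else 0 := by
  change ((1 : ℕ) : ℤ) - ((if y.1 0 = 0 then 0 else 1 : ℕ) : ℤ) = _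
  split_ifs <;> norm_num

lemma isOrderUnit_k2ex : IsOrderUnit matB2 (cohClass matB2 (natDiff 1 k2ex)) := by
  have hpos : ∀ y, 0 ≤ natDiff 1 k2ex y := by
    intro y
    rw [natDiff_one_k2ex_apply]
    split_ifs <;> norm_num
  refine isOrderUnit_of_nsmul_eq ⟨_, hpos, rfl⟩ two_pos
    (d := natDiff 1 k2ex + (natDiff 1 k2ex).comp (shiftMap matB2)) (fun y => ?_) ?_
  · change 1 ≤ natDiff 1 k2ex y + natDiff 1 k2ex (shift matB2 y)
    rcases (matB2_eq_one_iff _ _).mp (y.2 0) with h | h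
    · have h1 : natDiff 1 k2ex y = 1 := by rw [natDiff_one_k2ex_apply, if_pos h]
      linarith [hpos (shift matB2 y)]
    · have h1 : natDiff 1 k2ex (shift matB2 y) = 1 := by
        rw [natDiff_one_k2ex_apply, if_pos (by exact h)]
      linarith [hpos y]
  · refine Eq.symm (QuotientAddGroup.eq.mpr (AddSubgroup.subset_closure ⟨natDiff 1 k2ex, ?_⟩))
    change _ + 2 • natDiff 1 k2ex = _
    rw [two_nsmul]
    abel

theorem full_two_shift_flow_equivalent_golden_mean_shift :
    (∃ h : Space matA2 ≃ₜ Space matB2,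
      (∀ x : Space matA2, (h x).1 0 = x.1 0) ∧
      OrbitEqFns matA2 matB2 h 0 l1ex k2ex 1) ∧
    ContOrbitEquiv matA2 matB2 ∧ OneSidedFlowEquiv matA2 matB2 := by
  exact ⟨⟨substHomeo, fun _ => rfl, orbitEqFns_substHomeo⟩,
    ⟨substHomeo, 0, l1ex, k2ex, 1, orbitEqFns_substHomeo⟩,
    ⟨substHomeo, orbitEqFns_substHomeo.flowEquivVia isOrderUnit_l1ex isOrderUnit_k2ex⟩⟩

end OneSidedMarkov
end
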